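/- Let m ∈ {1,…,n−1} and 0 ≤ s < m. There exist constants a, b > 0 depending only on n, m and s such that for all x ∈ ℝ^n, all θ ∈ (0,1] and all 0 < r < 1/2, a ∫_{G(n,m)} φ̃_{r,θ}^s(π_V x) dγ_{n,m}(V) ≤ φ_{r,θ}^{s,m}(x) ≤ b ∫_{G(n,m)} φ̃_{r,θ}^s(π_V x) dγ_{n,m}(V). -/

import Mathlib

open MeasureTheory Metric Set Filter Topology
open scoped ENNReal NNReal

noncomputable section

/-- Euclidean space `ℝ^n`. -/
abbrev Euc (n : ℕ) := EuclideanSpace ℝ (Fin n)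

instance matrixMeasurableSpace (n : ℕ) : MeasurableSpace (Matrix (Fin n) (Fin n) ℝ) :=
  inferInstanceAs (MeasurableSpace (Fin n → Fin n → ℝ))

/-- The restricted covering sum `S_{r,θ}^s(E)`: the infimum of `Σ_i |U_i|^s` over all
countable covers `{U_i}` of `E` with `r ≤ |U_i| ≤ r^θ`, valued in `ℝ≥0∞`. -/
def coverSum (n : ℕ) (E : Set (Euc n)) (θ s r : ℝ) : ℝ≥0∞ :=
  sInf { T : ℝ≥0∞ | ∃ 𝒰 : Set (Set (Euc n)), 𝒰.Countable ∧ E ⊆ ⋃₀ 𝒰 ∧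
    (∀ U ∈ 𝒰, r ≤ diam U ∧ diam U ≤ r ^ θ) ∧
    T = ∑' U : 𝒰, ENNReal.ofReal (diam (U : Set (Euc n)) ^ s) }

/-- Real-valued version of `coverSum`. -/
def Sval (n : ℕ) (E : Set (Euc n)) (θ s r : ℝ) : ℝ := (coverSum n E θ s r).toReal

/-- The quotient `log S_{r,θ}^s(E) / (-log r)`. -/
def Squot (n : ℕ) (E : Set (Euc n)) (θ s r : ℝ) : ℝ :=
  Real.log (Sval n E θ s r) / (-Real.log r)

/-- `N_δ(E)`: the smallest number of sets of diameter at most `δ` needed to cover `E`. -/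
def covNum (n : ℕ) (E : Set (Euc n)) (δ : ℝ) : ℕ :=
  sInf { k : ℕ | ∃ U : Fin k → Set (Euc n), E ⊆ ⋃ i, U i ∧ ∀ i, diam (U i) ≤ δ }

/-- The lower box-counting dimension of `E`. -/
def lowerBoxDim (n : ℕ) (E : Set (Euc n)) : ℝ :=
  liminf (fun δ : ℝ => Real.log (covNum n E δ) / (-Real.log δ)) (𝓝[>] 0)

/-- The upper box-counting dimension of `E`. -/
def upperBoxDim (n : ℕ) (E : Set (Euc n)) : ℝ :=
  limsup (fun δ : ℝ => Real.log (covNum n E δ) / (-Real.log δ)) (𝓝[>] 0)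

/-- The kernel `φ_{r,θ}^{s,m}`. -/
def phiK (n : ℕ) (m s θ r : ℝ) (x : Euc n) : ℝ :=
  if ‖x‖ < r then 1
  else if ‖x‖ < r ^ θ then (r / ‖x‖) ^ s
  else r ^ (θ * (m - s) + s) / ‖x‖ ^ m

/-- The kernel `φ̃_{r,θ}^s`. -/
def phiT (n : ℕ) (s θ r : ℝ) (x : Euc n) : ℝ :=
  if ‖x‖ < r then 1
  else if ‖x‖ ≤ r ^ θ then (r / ‖x‖) ^ s
  else 0

/-- The kernel `φ_r^m(x) = min{1, (r/|x|)^m}`. -/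
def phiB (n : ℕ) (m r : ℝ) (x : Euc n) : ℝ :=
  if ‖x‖ ≤ r then 1 else (r / ‖x‖) ^ m

/-- The energy `∬ φ(x-y) dμ(x)dμ(y)` of a measure with respect to a kernel `φ`. -/
def energy (n : ℕ) (φ : Euc n → ℝ) (μ : Measure (Euc n)) : ℝ :=
  ∫ x, ∫ y, φ (x - y) ∂μ ∂μ

/-- The potential `∫ φ(x-y) dμ(y)` of a measure at `x` with respect to a kernel `φ`. -/
def potential (n : ℕ) (φ : Euc n → ℝ) (μ : Measure (Euc n)) (x : Euc n) : ℝ :=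
  ∫ y, φ (x - y) ∂μ

/-- `μ` is a Borel probability measure supported on `E`. -/
def PMeasOn (n : ℕ) (E : Set (Euc n)) (μ : Measure (Euc n)) : Prop :=
  IsProbabilityMeasure μ ∧ μ Eᶜ = 0

/-- The capacity `C_{r,θ}^{s,m}(E)`: the reciprocal of the infimal energy of Borel
probability measures supported on `E` with respect to the kernel `φ_{r,θ}^{s,m}`. -/
def capacity (n : ℕ) (m s θ r : ℝ) (E : Set (Euc n)) : ℝ :=
  (sInf { e : ℝ | ∃ μ : Measure (Euc n), PMeasOn n E μ ∧ e = energy n (phiK n m s θ r) μ })⁻¹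

/-- The quotient `log C_{r,θ}^{s,m}(E) / (-log r)`. -/
def Cquot (n : ℕ) (m s θ : ℝ) (E : Set (Euc n)) (r : ℝ) : ℝ :=
  Real.log (capacity n m s θ r E) / (-Real.log r)

/-- `d` is the lower intermediate dimension `\underline{dim}_θ E`, i.e. the unique
`s ∈ [0,n]` such that `liminf_{r→0} log S_{r,θ}^s(E) / (-log r) = 0`. -/
def IsLowerInterDim (n : ℕ) (θ : ℝ) (E : Set (Euc n)) (d : ℝ) : Prop :=
  d ∈ Icc (0:ℝ) n ∧ liminf (fun r => Squot n E θ d r) (𝓝[>] 0) = 0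

/-- `d` is the upper intermediate dimension `\overline{dim}_θ E`. -/
def IsUpperInterDim (n : ℕ) (θ : ℝ) (E : Set (Euc n)) (d : ℝ) : Prop :=
  d ∈ Icc (0:ℝ) n ∧ limsup (fun r => Squot n E θ d r) (𝓝[>] 0) = 0

/-- `d` is the lower intermediate dimension profile `\underline{dim}_θ^m E`, i.e. the unique
`s ∈ [0,m]` such that `liminf_{r→0} log C_{r,θ}^{s,m}(E) / (-log r) = s`; for bounded sets the
capacity is that of the closure. -/
def IsLowerDimProfile (n m : ℕ) (θ : ℝ) (E : Set (Euc n)) (d : ℝ) : Prop :=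
  d ∈ Icc (0:ℝ) m ∧ liminf (fun r => Cquot n m d θ (closure E) r) (𝓝[>] 0) = d

/-- `d` is the upper intermediate dimension profile `\overline{dim}_θ^m E`. -/
def IsUpperDimProfile (n m : ℕ) (θ : ℝ) (E : Set (Euc n)) (d : ℝ) : Prop :=
  d ∈ Icc (0:ℝ) m ∧ limsup (fun r => Cquot n m d θ (closure E) r) (𝓝[>] 0) = d

/-- `P` is the matrix of an orthogonal projection of `ℝ^n` onto an `m`-dimensional subspace;
such matrices parametrise the Grassmannian `G(n,m)`. -/
def IsProjMat (n m : ℕ) (P : Matrix (Fin n) (Fin n) ℝ) : Prop :=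
  P.transpose = P ∧ P * P = P ∧ P.rank = m

/-- The orthogonal projection map `π_V` associated to a projection matrix. -/
def projMap (n : ℕ) (P : Matrix (Fin n) (Fin n) ℝ) : Euc n → Euc n :=
  fun x => Matrix.toEuclideanLin P x

/-- `γ` is the natural invariant measure `γ_{n,m}` on the Grassmannian `G(n,m)` (realised as
the space of orthogonal projection matrices of rank `m`): a probability measure supported on
the rank-`m` orthogonal projections and invariant under the action of the orthogonal group. -/
def IsGrassMeasure (n m : ℕ) (γ : Measure (Matrix (Fin n) (Fin n) ℝ)) : Prop :=
  IsProbabilityMeasure γ ∧ γ {P | IsProjMat n m P}ᶜ = 0 ∧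
  ∀ A ∈ Matrix.orthogonalGroup (Fin n) ℝ,
    Measure.map (fun P => A * P * A.transpose) γ = γ

theorem lintegral_fin_prod_eq_prod {n : ℕ} (f : Fin n → ℝ → ℝ≥0∞) (hf : ∀ i, Measurable (f i)) :
    ∫⁻ y : Fin n → ℝ, ∏ i, f i (y i) = ∏ i, ∫⁻ τ, f i τ := by
  induction n with
  | zero => simp [volume_pi]
  | succ n ih =>
    have hmp := (volume_preserving_piFinSuccAbove (fun _ : Fin (n + 1) => ℝ) 0).symm
    have hg : Measurable fun y : Fin n → ℝ => ∏ i : Fin n, f i.succ (y i) :=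
      Finset.measurable_prod _ fun i _ => (hf i.succ).comp (measurable_pi_apply i)
    rw [← hmp.lintegral_comp_emb (MeasurableEquiv.measurableEmbedding _), Fin.prod_univ_succ,
      ← ih _ fun i => hf i.succ, ← lintegral_prod_mul (hf 0).aemeasurable hg.aemeasurable]
    refine lintegral_congr fun p => ?_
    simp [MeasurableEquiv.piFinSuccAbove_symm_apply, Fin.insertNthEquiv, Fin.prod_univ_succ]

/-- The profile `τ ↦ τ^{-s}` cut off above `t`; it is infinite at `0` if `0 < s`. -/
def truncPow (s t τ : ℝ) : ℝ≥0∞ := if τ ≤ t then ENNReal.ofReal τ ^ (-s) else 0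

theorem measurable_truncPow (s t : ℝ) : Measurable (truncPow s t) :=
  Measurable.ite measurableSet_Iic (ENNReal.measurable_ofReal.pow_const _) measurable_const

theorem antitone_truncPow {s : ℝ} (hs : 0 ≤ s) (t : ℝ) : Antitone (truncPow s t) := by
  intro τ τ' h
  unfold truncPow
  by_cases h' : τ' ≤ t
  · rw [if_pos h', if_pos (h.trans h'), ENNReal.rpow_neg, ENNReal.rpow_neg]
    gcongr
  · simp [h']

theorem lintegral_truncPow_abs_le {c t : ℝ} (hc : c < 1) (ht : 0 < t) :
    ∫⁻ τ, truncPow c t |τ| ≤ ENNReal.ofReal (2 * (t ^ (1 - c) / (1 - c))) := by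
  set h : ℝ → ℝ≥0∞ := (Icc 0 t).indicator fun τ => ENNReal.ofReal τ ^ (-c) with hh
  have hm : Measurable h :=
    (ENNReal.measurable_ofReal.pow_const _).indicator measurableSet_Icc
  have hle : ∀ τ, truncPow c t |τ| ≤ h τ + h (-τ) := by
    intro τ
    unfold truncPow
    split_ifs with hτ
    · rcases le_total 0 τ with h0 | h0
      · rw [abs_of_nonneg h0] at hτ ⊢
        refine le_add_right ?_
        rw [hh, indicator_of_mem (show τ ∈ Icc 0 t from ⟨h0, hτ⟩)]
      · rw [abs_of_nonpos h0] at hτ ⊢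
        refine le_add_left ?_
        rw [hh, indicator_of_mem (show -τ ∈ Icc 0 t from ⟨by linarith, hτ⟩)]
    · exact zero_le
  have hI : ∫⁻ τ, h τ = ENNReal.ofReal (t ^ (1 - c) / (1 - c)) := by
    rw [hh, lintegral_indicator measurableSet_Icc, ← restrict_Ioc_eq_restrict_Icc,
      setLIntegral_congr_fun (g := fun τ => ENNReal.ofReal (τ ^ (-c))) measurableSet_Ioc
        fun τ hτ => ENNReal.ofReal_rpow_of_pos hτ.1]
    have hint : IntegrableOn (fun τ : ℝ => τ ^ (-c)) (Ioc 0 t) :=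
      (intervalIntegrable_iff_integrableOn_Ioc_of_le ht.le).1
        (intervalIntegral.intervalIntegrable_rpow' (by linarith))
    rw [← ofReal_integral_eq_lintegral_ofReal hint
      ((ae_restrict_mem measurableSet_Ioc).mono fun τ hτ => Real.rpow_nonneg hτ.1.le _),
      ← intervalIntegral.integral_of_le ht.le, integral_rpow (Or.inl (by linarith)),
      Real.zero_rpow (by linarith)]
    congr 1
    ring_nf
  calc ∫⁻ τ, truncPow c t |τ| ≤ ∫⁻ τ, (h τ + h (-τ)) := lintegral_mono hle
    _ = ENNReal.ofReal (t ^ (1 - c) / (1 - c)) + ENNReal.ofReal (t ^ (1 - c) / (1 - c)) := by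
      rw [lintegral_add_left hm, lintegral_neg_eq_self h, hI]
    _ = _ := by
      rw [← ENNReal.ofReal_add, ← two_mul] <;>
        exact div_nonneg (Real.rpow_nonneg ht.le _) (by linarith)

theorem exists_orthonormalBasis_norm_projMap_sq {n m : ℕ} {P : Matrix (Fin n) (Fin n) ℝ}
    (hP : IsProjMat n m P) :
    ∃ (b : OrthonormalBasis (Fin n) ℝ (Euc n)) (S : Finset (Fin n)), S.card = m ∧
      ∀ x, ‖projMap n P x‖ ^ 2 = ∑ i ∈ S, (b.repr x i) ^ 2 := by
  obtain ⟨hsymm, hidem, hrank⟩ := hP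
  have hA : P.IsHermitian := by
    rw [Matrix.IsHermitian, Matrix.conjTranspose_eq_transpose_of_trivial, hsymm]
  have happ : ∀ j, Matrix.toEuclideanLin P (hA.eigenvectorBasis j)
      = hA.eigenvalues j • hA.eigenvectorBasis j := by
    intro j
    ext i
    exact congrFun (hA.mulVec_eigenvectorBasis j) i
  have hidem' : ∀ x, Matrix.toEuclideanLin P (Matrix.toEuclideanLin P x)
      = Matrix.toEuclideanLin P x := by
    intro x
    ext i
    simp [Matrix.toLpLin_apply, Matrix.mulVec_mulVec, hidem]
  have hev : ∀ j, hA.eigenvalues j ^ 2 = hA.eigenvalues j := by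
    intro j
    have h := hidem' (hA.eigenvectorBasis j)
    rw [happ, map_smul, happ, smul_smul] at h
    have hne : hA.eigenvectorBasis j ≠ 0 := hA.eigenvectorBasis.orthonormal.ne_zero j
    rw [sq]
    exact smul_left_injective ℝ hne h
  refine ⟨hA.eigenvectorBasis, Finset.univ.filter fun i => hA.eigenvalues i ≠ 0, ?_, ?_⟩
  · rw [← hrank, hA.rank_eq_card_non_zero_eigs, Fintype.card_subtype]
  · intro x
    have hcoord : ∀ i, hA.eigenvectorBasis.repr (projMap n P x) i
        = hA.eigenvalues i * hA.eigenvectorBasis.repr x i := by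
      intro i
      have hs := Matrix.isSymmetric_toEuclideanLin_iff.mpr hA
      rw [hA.eigenvectorBasis.repr_apply_apply, hA.eigenvectorBasis.repr_apply_apply, projMap,
        ← hs, happ, real_inner_smul_left]
    rw [← hA.eigenvectorBasis.repr.norm_map, EuclideanSpace.real_norm_sq_eq, Finset.sum_filter]
    refine Finset.sum_congr rfl fun i _ => ?_
    rw [hcoord, mul_pow, hev]
    rcases eq_or_ne (hA.eigenvalues i) 0 with h0 | h0
    · simp [h0]
    · have h1 : hA.eigenvalues i = 1 := by
        have := hev i
        rw [sq] at this
        exact mul_left_cancel₀ h0 (by simpa using this)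
      simp [h1]

theorem norm_projMap_le {n m : ℕ} {P : Matrix (Fin n) (Fin n) ℝ} (hP : IsProjMat n m P)
    (x : Euc n) : ‖projMap n P x‖ ≤ ‖x‖ := by
  obtain ⟨b, S, -, h⟩ := exists_orthonormalBasis_norm_projMap_sq hP
  refine le_of_sq_le_sq ?_ (norm_nonneg _)
  rw [h, ← b.repr.norm_map x, EuclideanSpace.real_norm_sq_eq]
  exact Finset.sum_le_univ_sum_of_nonneg fun i => sq_nonneg _

theorem OrthonormalBasis.measurePreserving_ofLp_repr {n : ℕ}
    (b : OrthonormalBasis (Fin n) ℝ (Euc n)) :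
    MeasurePreserving (fun x => WithLp.ofLp (b.repr x)) volume volume :=
  (PiLp.volume_preserving_ofLp (Fin n)).comp b.measurePreserving_repr

theorem setLIntegral_truncPow_norm_projMap_le {n m : ℕ} (hm : 1 ≤ m) {s t : ℝ}
    (hs : 0 ≤ s) (hsm : s < m) (ht : 0 < t) {P : Matrix (Fin n) (Fin n) ℝ}
    (hP : IsProjMat n m P) :
    ∫⁻ x in closedBall (0 : Euc n) 1, truncPow s t ‖projMap n P x‖ ≤
      ENNReal.ofReal ((2 / (1 - s / m)) ^ m * 2 ^ (n - m)) * ENNReal.ofReal (t ^ (m - s)) := by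
  obtain ⟨b, S, hS, hsq⟩ := exists_orthonormalBasis_norm_projMap_sq hP
  have hm0 : (0 : ℝ) < m := by exact_mod_cast hm
  have hc : s / m < 1 := (div_lt_one hm0).2 hsm
  have hc0 : 0 ≤ s / m := by positivity
  set f : Fin n → ℝ → ℝ≥0∞ := fun i τ =>
    if i ∈ S then truncPow (s / m) t |τ| else (Icc (-1 : ℝ) 1).indicator 1 τ with hf
  have hfm : ∀ i, Measurable (f i) := by
    intro i
    by_cases hi : i ∈ S
    · simp only [hf, hi, if_true]
      exact (measurable_truncPow _ _).comp measurable_abs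
    · simp only [hf, hi, if_false]
      exact measurable_one.indicator measurableSet_Icc
  have hle : ∀ x ∈ closedBall (0 : Euc n) 1,
      truncPow s t ‖projMap n P x‖ ≤ ∏ i, f i (b.repr x i) := by
    intro x hx
    by_cases hxt : ‖projMap n P x‖ ≤ t
    · have hprod : truncPow s t ‖projMap n P x‖
          = ∏ i, if i ∈ S then truncPow (s / m) t ‖projMap n P x‖ else 1 := by
        rw [Finset.prod_ite_mem, Finset.univ_inter, Finset.prod_const, hS, truncPow, truncPow,
          if_pos hxt, if_pos hxt, ← ENNReal.rpow_natCast, ← ENNReal.rpow_mul]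
        congr 1
        field_simp
      rw [hprod]
      refine Finset.prod_le_prod' fun i _ => ?_
      by_cases hi : i ∈ S
      · simp only [hf, hi, if_true]
        refine antitone_truncPow hc0 t (abs_le_of_sq_le_sq ?_ (norm_nonneg _))
        rw [hsq]
        exact Finset.single_le_sum (f := fun i => b.repr x i ^ 2) (fun i _ => sq_nonneg _) hi
      · simp only [hf, hi, if_false]
        have h1 : |b.repr x i| ≤ 1 := by
          have := PiLp.norm_apply_le (b.repr x) i
          rw [b.repr.norm_map] at this
          exact this.trans (by simpa using hx)
        rw [indicator_of_mem (show b.repr x i ∈ Icc (-1 : ℝ) 1 from abs_le.1 h1)]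
        rfl
    · simp [truncPow, hxt]
  calc ∫⁻ x in closedBall (0 : Euc n) 1, truncPow s t ‖projMap n P x‖
      ≤ ∫⁻ x in closedBall (0 : Euc n) 1, ∏ i, f i (b.repr x i) :=
        setLIntegral_mono' measurableSet_closedBall hle
    _ ≤ ∫⁻ x : Euc n, ∏ i, f i (b.repr x i) := setLIntegral_le_lintegral _ _
    _ = ∫⁻ y : Fin n → ℝ, ∏ i, f i (y i) :=
        b.measurePreserving_ofLp_repr.lintegral_comp
          (Finset.measurable_prod _ fun i _ => (hfm i).comp (measurable_pi_apply i))
    _ = ∏ i, ∫⁻ τ, f i τ := lintegral_fin_prod_eq_prod f hfm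
    _ ≤ ∏ i, if i ∈ S then ENNReal.ofReal (2 * (t ^ (1 - s / m) / (1 - s / m)))
          else ENNReal.ofReal 2 := by
        refine Finset.prod_le_prod' fun i _ => ?_
        by_cases hi : i ∈ S
        · simp only [hf, hi, if_true]
          exact lintegral_truncPow_abs_le hc ht
        · simp only [hf, hi, if_false]
          rw [lintegral_indicator_one measurableSet_Icc, Real.volume_Icc]
          norm_num
    _ = _ := by
        have hpos : 0 < 1 - s / m := by linarith
        have hcard : (Finset.univ.filter fun i => i ∉ S).card = n - m := by
          have h2 : (Finset.univ.filter fun i => i ∉ S) = Sᶜ := by ext i; simp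
          rw [h2, Finset.card_compl, Fintype.card_fin, hS]
        rw [Finset.prod_ite, Finset.prod_const, Finset.prod_const, hcard, Finset.filter_mem_eq_inter,
          Finset.univ_inter, hS, ← ENNReal.ofReal_pow (by positivity),
          ← ENNReal.ofReal_pow (by positivity), ← ENNReal.ofReal_mul (by positivity),
          ← ENNReal.ofReal_mul (by positivity)]
        congr 1
        have h3 : t ^ ((m : ℝ) - s) = (t ^ (1 - s / m)) ^ m := by
          rw [← Real.rpow_natCast, ← Real.rpow_mul ht.le]
          congr 1
          field_simp
        rw [h3]
        ring

theorem le_volume_norm_projMap_le {n m : ℕ} (hm : 1 ≤ m) (hmn : m < n) {t : ℝ}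
    (ht : 0 < t) (ht1 : t ≤ 1) {P : Matrix (Fin n) (Fin n) ℝ} (hP : IsProjMat n m P) :
    ENNReal.ofReal ((t / n) ^ m) ≤
      volume {x : Euc n | (1 ≤ ‖x‖ ∧ ‖x‖ ≤ 2 * n) ∧ ‖projMap n P x‖ ≤ t} := by
  obtain ⟨b, S, hS, hsq⟩ := exists_orthonormalBasis_norm_projMap_sq hP
  have hn0 : (0 : ℝ) < n := by exact_mod_cast (by omega : 0 < n)
  have hn1 : (1 : ℝ) ≤ n := by exact_mod_cast (by omega : 1 ≤ n)
  have hmn' : (m : ℝ) ≤ n := by exact_mod_cast hmn.le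
  set B : Fin n → Set ℝ := fun i => if i ∈ S then Icc 0 (t / n) else Icc 1 2 with hB
  have hBm : ∀ i, MeasurableSet (B i) := by
    intro i
    by_cases hi : i ∈ S <;> simp [hB, hi]
  have hvol : volume (Set.univ.pi B) = ENNReal.ofReal ((t / n) ^ m) := by
    rw [volume_pi_pi]
    have : ∀ i, volume (B i) = if i ∈ S then ENNReal.ofReal (t / n) else 1 := by
      intro i
      by_cases hi : i ∈ S
      · simp [hB, hi]
      · simp only [hB, hi, if_false, Real.volume_Icc]
        norm_num
    simp_rw [this]
    rw [Finset.prod_ite_mem, Finset.univ_inter, Finset.prod_const, hS,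
      ENNReal.ofReal_pow (by positivity)]
  rw [← hvol, ← b.measurePreserving_ofLp_repr.measure_preimage
    (MeasurableSet.univ_pi hBm).nullMeasurableSet]
  refine measure_mono fun x hx => ?_
  have hx' : ∀ i, b.repr x i ∈ B i := fun i => hx i (mem_univ i)
  have hin : ∀ i ∈ S, 0 ≤ b.repr x i ∧ b.repr x i ≤ t / n := by
    intro i hi
    simpa [hB, hi] using hx' i
  have hout : ∀ i ∉ S, 1 ≤ b.repr x i ∧ b.repr x i ≤ 2 := by
    intro i hi
    simpa [hB, hi] using hx' i
  have htn : t / n ≤ 1 := (div_le_one hn0).2 (ht1.trans hn1)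
  refine ⟨⟨?_, ?_⟩, ?_⟩
  · obtain ⟨i, hi⟩ : ∃ i, i ∉ S := by
      by_contra! h
      have : S = Finset.univ := Finset.eq_univ_iff_forall.2 h
      rw [this, Finset.card_univ, Fintype.card_fin] at hS
      omega
    rw [← b.repr.norm_map]
    exact (hout i hi).1.trans ((le_abs_self _).trans (PiLp.norm_apply_le (b.repr x) i))
  · refine le_of_sq_le_sq ?_ (by positivity)
    rw [← b.repr.norm_map, EuclideanSpace.real_norm_sq_eq]
    calc ∑ i, b.repr x i ^ 2 ≤ ∑ _i : Fin n, (4 : ℝ) := by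
          refine Finset.sum_le_sum fun i _ => ?_
          by_cases hi : i ∈ S
          · nlinarith [hin i hi]
          · nlinarith [hout i hi]
      _ = 4 * n := by simp [mul_comm]
      _ ≤ (2 * n) ^ 2 := by nlinarith
  · refine le_of_sq_le_sq ?_ ht.le
    rw [hsq]
    calc ∑ i ∈ S, b.repr x i ^ 2 ≤ ∑ _i ∈ S, (t / n) ^ 2 :=
          Finset.sum_le_sum fun i hi => pow_le_pow_left₀ (hin i hi).1 (hin i hi).2 2
      _ = m * (t / n) ^ 2 := by simp [hS]
      _ ≤ n ^ 2 * (t / n) ^ 2 := by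
          gcongr
          nlinarith
      _ = t ^ 2 := by field_simp

theorem StarAlgEquiv.apply_mem_unitary {A B : Type*} [Ring A] [StarRing A] [Algebra ℝ A] [Ring B]
    [StarRing B] [Algebra ℝ B] (f : A ≃⋆ₐ[ℝ] B) {u : A} (hu : u ∈ unitary A) :
    f u ∈ unitary B := by
  rw [Unitary.mem_iff] at hu ⊢
  rw [← map_star, ← map_mul, ← map_mul, hu.1, hu.2, map_one]
  exact ⟨rfl, rfl⟩

theorem exists_orthogonalGroup_toEuclideanLin_eq {n : ℕ} {x y : Euc n} (h : ‖x‖ = ‖y‖) :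
    ∃ A ∈ Matrix.orthogonalGroup (Fin n) ℝ, (∀ z, ‖Matrix.toEuclideanLin A z‖ = ‖z‖) ∧
      Matrix.toEuclideanLin A.transpose y = x := by
  set e : Euc n ≃ₗᵢ[ℝ] Euc n := (ℝ ∙ (x - y))ᗮ.reflection
  have hx : e x = y := Submodule.reflection_sub h
  set A : Matrix (Fin n) (Fin n) ℝ := Matrix.toEuclideanCLM (𝕜 := ℝ).symm (e : Euc n →L[ℝ] Euc n)
  have hAe : ∀ z, Matrix.toEuclideanLin A z = e z := by
    intro z
    rw [← Matrix.coe_toEuclideanCLM_eq_toEuclideanLin]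
    simp [A]
  have hA : A ∈ Matrix.orthogonalGroup (Fin n) ℝ :=
    (Matrix.toEuclideanCLM (𝕜 := ℝ) (n := Fin n)).symm.apply_mem_unitary
      (Unitary.linearIsometryEquiv.symm e).2
  refine ⟨A, hA, fun z => by rw [hAe, e.norm_map], ?_⟩
  rw [← hx, ← hAe]
  have h1 : A.transpose * A = 1 := (Matrix.mem_orthogonalGroup_iff' (Fin n) ℝ).1 hA
  ext i
  simp [Matrix.toLpLin_apply, Matrix.mulVec_mulVec, h1]

theorem measurable_matrix_apply {n : ℕ} (i j : Fin n) :
    Measurable fun M : Matrix (Fin n) (Fin n) ℝ => M i j :=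
  (measurable_pi_apply j).comp (measurable_pi_apply (X := fun _ => Fin n → ℝ) i)

theorem measurable_norm_projMap {n : ℕ} :
    Measurable fun p : Matrix (Fin n) (Fin n) ℝ × Euc n => ‖projMap n p.1 p.2‖ := by
  simp only [EuclideanSpace.norm_eq, projMap, Matrix.toLpLin_apply, Matrix.mulVec, dotProduct]
  refine Measurable.sqrt (Finset.measurable_sum _ fun i _ => ?_)
  refine (Measurable.norm (Finset.measurable_sum _ fun j _ => ?_)).pow_const 2
  exact ((measurable_matrix_apply i j).comp measurable_fst).mul (by fun_prop)

theorem measurable_norm_projMap_left {n : ℕ} (x : Euc n) :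
    Measurable fun P : Matrix (Fin n) (Fin n) ℝ => ‖projMap n P x‖ := by
  have h : Measurable fun P : Matrix (Fin n) (Fin n) ℝ => (P, x) := measurable_prodMk_right
  simpa only [Function.comp_def] using (measurable_norm_projMap (n := n)).comp h

theorem measurable_norm_projMap_right {n : ℕ} (P : Matrix (Fin n) (Fin n) ℝ) :
    Measurable fun x : Euc n => ‖projMap n P x‖ := by
  have h : Measurable fun x : Euc n => (P, x) := measurable_prodMk_left
  simpa only [Function.comp_def] using (measurable_norm_projMap (n := n)).comp h

section GrassMeasure

variable {n m : ℕ} {γ : Measure (Matrix (Fin n) (Fin n) ℝ)}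

theorem IsGrassMeasure.ae_isProjMat (hγ : IsGrassMeasure n m γ) : ∀ᵐ P ∂γ, IsProjMat n m P :=
  hγ.2.1

theorem IsGrassMeasure.lintegral_norm_projMap_congr (hγ : IsGrassMeasure n m γ)
    {F : ℝ → ℝ≥0∞} (hF : Measurable F) {x y : Euc n} (h : ‖x‖ = ‖y‖) :
    ∫⁻ P, F ‖projMap n P x‖ ∂γ = ∫⁻ P, F ‖projMap n P y‖ ∂γ := by
  obtain ⟨A, hA, hnorm, hx⟩ := exists_orthogonalGroup_toEuclideanLin_eq h
  have hmeas : Measurable fun P : Matrix (Fin n) (Fin n) ℝ => A * P * A.transpose := by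
    refine measurable_pi_lambda _ fun i => measurable_pi_lambda _ fun j => ?_
    simp only [Matrix.mul_apply]
    refine Finset.measurable_sum _ fun k _ => Measurable.mul_const ?_ _
    refine Finset.measurable_sum _ fun l _ => Measurable.const_mul ?_ _
    exact measurable_matrix_apply _ _
  have hmap := hγ.2.2 A hA
  conv_rhs => rw [← hmap]
  rw [lintegral_map (f := fun P => F ‖projMap n P y‖)
    (hF.comp (measurable_norm_projMap_left y)) hmeas]
  refine lintegral_congr fun P => ?_
  have : projMap n (A * P * A.transpose) y = Matrix.toEuclideanLin A (projMap n P x) := by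
    rw [← hx]
    ext i
    simp [projMap, Matrix.toLpLin_apply, Matrix.mulVec_mulVec, Matrix.mul_assoc]
  rw [this, hnorm]

theorem projMap_smul (P : Matrix (Fin n) (Fin n) ℝ) (c : ℝ) (x : Euc n) :
    projMap n P (c • x) = c • projMap n P x :=
  map_smul _ c x

theorem IsGrassMeasure.lintegral_norm_projMap_anti (hγ : IsGrassMeasure n m γ)
    {F : ℝ → ℝ≥0∞} (hFm : Measurable F) (hF : Antitone F) {x y : Euc n} (h : ‖x‖ ≤ ‖y‖) :
    ∫⁻ P, F ‖projMap n P y‖ ∂γ ≤ ∫⁻ P, F ‖projMap n P x‖ ∂γ := by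
  rcases eq_or_ne y 0 with rfl | hy
  · have hx : x = 0 := by simpa using h
    rw [hx]
  have hy0 : 0 < ‖y‖ := norm_pos_iff.2 hy
  set c : ℝ := ‖x‖ / ‖y‖ with hc
  have hc0 : 0 ≤ c := by positivity
  have hc1 : c ≤ 1 := (div_le_one hy0).2 h
  have hnorm : ‖c • y‖ = ‖x‖ := by
    rw [norm_smul, Real.norm_of_nonneg hc0, hc, div_mul_cancel₀ _ hy0.ne']
  rw [← hγ.lintegral_norm_projMap_congr hFm hnorm]
  refine lintegral_mono fun P => hF ?_
  rw [projMap_smul, norm_smul, Real.norm_of_nonneg hc0]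
  exact mul_le_of_le_one_left (norm_nonneg _) hc1

theorem lintegral_setLIntegral_norm_projMap_swap [SFinite γ] {F : ℝ → ℝ≥0∞} (hF : Measurable F)
    (A : Set (Euc n)) :
    ∫⁻ x in A, ∫⁻ P, F ‖projMap n P x‖ ∂γ = ∫⁻ P, (∫⁻ x in A, F ‖projMap n P x‖) ∂γ :=
  lintegral_lintegral_swap (f := fun x P => F ‖projMap n P x‖)
    ((hF.comp (measurable_norm_projMap.comp measurable_swap)).aemeasurable)

theorem IsGrassMeasure.exists_lintegral_truncPow_le (hγ : IsGrassMeasure n m γ) (hm : 1 ≤ m)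
    {s : ℝ} (hs : 0 ≤ s) (hsm : s < m) :
    ∃ C : ℝ, 0 < C ∧ ∀ u : Euc n, ‖u‖ = 1 → ∀ t : ℝ, 0 < t →
      ∫⁻ P, truncPow s t ‖projMap n P u‖ ∂γ ≤ ENNReal.ofReal (C * t ^ (m - s)) := by
  have := hγ.1
  have hm0 : (0 : ℝ) < m := by exact_mod_cast hm
  have hc : 0 < 1 - s / m := by
    have := (div_lt_one hm0).2 hsm
    linarith
  set K : ℝ := (2 / (1 - s / m)) ^ m * 2 ^ (n - m)
  have hK : 0 < K := by positivity
  set V := volume (closedBall (0 : Euc n) 1)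
  have hV0 : V ≠ 0 := (measure_closedBall_pos volume _ one_pos).ne'
  have hVt : V ≠ ⊤ := measure_closedBall_lt_top.ne
  have hv : 0 < V.toReal := ENNReal.toReal_pos hV0 hVt
  refine ⟨K / V.toReal, by positivity, fun u hu t ht => ?_⟩
  have hFm := measurable_truncPow s t
  have key : (∫⁻ P, truncPow s t ‖projMap n P u‖ ∂γ) * V
      ≤ ENNReal.ofReal K * ENNReal.ofReal (t ^ (m - s)) := by
    calc (∫⁻ P, truncPow s t ‖projMap n P u‖ ∂γ) * V
        = ∫⁻ _ in closedBall (0 : Euc n) 1, ∫⁻ P, truncPow s t ‖projMap n P u‖ ∂γ := by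
          rw [setLIntegral_const]
      _ ≤ ∫⁻ x in closedBall (0 : Euc n) 1, ∫⁻ P, truncPow s t ‖projMap n P x‖ ∂γ := by
          refine setLIntegral_mono' measurableSet_closedBall fun x hx => ?_
          exact hγ.lintegral_norm_projMap_anti hFm (antitone_truncPow hs t)
            (by rw [hu]; simpa using hx)
      _ = ∫⁻ P, (∫⁻ x in closedBall (0 : Euc n) 1, truncPow s t ‖projMap n P x‖) ∂γ :=
          lintegral_setLIntegral_norm_projMap_swap hFm _
      _ ≤ ∫⁻ _, ENNReal.ofReal K * ENNReal.ofReal (t ^ (m - s)) ∂γ := by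
          refine lintegral_mono_ae (hγ.ae_isProjMat.mono fun P hP => ?_)
          exact setLIntegral_truncPow_norm_projMap_le hm hs hsm ht hP
      _ = _ := by simp
  rw [div_mul_eq_mul_div, ENNReal.ofReal_div_of_pos hv, ENNReal.ofReal_toReal hVt,
    ENNReal.ofReal_mul hK.le]
  exact (ENNReal.le_div_iff_mul_le (Or.inl hV0) (Or.inl hVt)).2 key

theorem IsGrassMeasure.exists_le_measure_norm_projMap_le (hγ : IsGrassMeasure n m γ)
    (hm : 1 ≤ m) (hmn : m < n) :
    ∃ c : ℝ, 0 < c ∧ ∀ u : Euc n, ‖u‖ = 1 → ∀ t : ℝ, 0 < t → t ≤ 1 →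
      ENNReal.ofReal (c * t ^ m) ≤ γ {P | ‖projMap n P u‖ ≤ t} := by
  have := hγ.1
  have hn0 : (0 : ℝ) < n := by exact_mod_cast (by omega : 0 < n)
  set A : Set (Euc n) := {x | 1 ≤ ‖x‖ ∧ ‖x‖ ≤ 2 * n}
  have hAm : MeasurableSet A :=
    (measurableSet_le measurable_const measurable_norm).inter
      (measurableSet_le measurable_norm measurable_const)
  set V := volume A
  have hVt : V ≠ ⊤ := by
    refine ((measure_mono fun x hx => ?_).trans_lt
      (measure_closedBall_lt_top (x := (0 : Euc n)) (r := 2 * n))).ne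
    simpa using hx.2
  have key : ∀ u : Euc n, ‖u‖ = 1 → ∀ t : ℝ, 0 < t → t ≤ 1 →
      ENNReal.ofReal ((t / n) ^ m) ≤ γ {P | ‖projMap n P u‖ ≤ t} * V := by
    intro u hu t ht ht1
    set F : ℝ → ℝ≥0∞ := (Iic t).indicator 1
    have hFm : Measurable F := measurable_one.indicator measurableSet_Iic
    have hF : Antitone F := by
      intro τ τ' h
      by_cases h' : τ' ≤ t
      · simp [F, h', h.trans h']
      · simp [F, h']
    have hmeas : ∀ x, MeasurableSet {P : Matrix (Fin n) (Fin n) ℝ | ‖projMap n P x‖ ≤ t} :=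
      fun x => measurableSet_le (measurable_norm_projMap_left x) measurable_const
    have hFu : ∫⁻ P, F ‖projMap n P u‖ ∂γ = γ {P | ‖projMap n P u‖ ≤ t} := by
      rw [← lintegral_indicator_one (hmeas u)]
      rfl
    calc ENNReal.ofReal ((t / n) ^ m) = ∫⁻ _, ENNReal.ofReal ((t / n) ^ m) ∂γ := by simp
      _ ≤ ∫⁻ P, (∫⁻ x in A, F ‖projMap n P x‖) ∂γ := by
          refine lintegral_mono_ae (hγ.ae_isProjMat.mono fun P hP => ?_)
          refine (le_volume_norm_projMap_le hm hmn ht ht1 hP).trans_eq ?_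
          have hPm : MeasurableSet {x : Euc n | ‖projMap n P x‖ ≤ t} :=
            measurableSet_le (measurable_norm_projMap_right P) measurable_const
          have : ∀ x, F ‖projMap n P x‖ = {x : Euc n | ‖projMap n P x‖ ≤ t}.indicator 1 x :=
            fun x => rfl
          simp_rw [this]
          rw [lintegral_indicator_one hPm, Measure.restrict_apply hPm, inter_comm]
          rfl
      _ = ∫⁻ x in A, ∫⁻ P, F ‖projMap n P x‖ ∂γ :=
          (lintegral_setLIntegral_norm_projMap_swap hFm A).symm
      _ ≤ ∫⁻ _ in A, ∫⁻ P, F ‖projMap n P u‖ ∂γ := by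
          refine setLIntegral_mono' hAm fun x hx => ?_
          exact hγ.lintegral_norm_projMap_anti hFm hF (by rw [hu]; exact hx.1)
      _ = _ := by rw [setLIntegral_const, hFu]
  have hV0 : V ≠ 0 := by
    intro h
    have h1 := key (EuclideanSpace.single ⟨0, by omega⟩ 1) (by simp) 1 one_pos le_rfl
    rw [h, mul_zero, nonpos_iff_eq_zero, ENNReal.ofReal_eq_zero] at h1
    exact absurd h1 (not_le.2 (by positivity))
  have hv : 0 < V.toReal := ENNReal.toReal_pos hV0 hVt
  refine ⟨1 / (n ^ m * V.toReal), by positivity, fun u hu t ht ht1 => ?_⟩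
  have : 1 / (n ^ m * V.toReal) * t ^ m = (t / n) ^ m / V.toReal := by
    rw [div_pow]
    field_simp
  rw [this, ENNReal.ofReal_div_of_pos hv, ENNReal.ofReal_toReal hVt]
  exact ENNReal.div_le_of_le_mul (key u hu t ht ht1)

end GrassMeasure

theorem phiT_nonneg {n : ℕ} {s θ r : ℝ} (hr : 0 < r) (y : Euc n) : 0 ≤ phiT n s θ r y := by
  unfold phiT
  split_ifs <;> positivity

theorem phiT_le_one {n : ℕ} {s θ r : ℝ} (hs : 0 ≤ s) (hr : 0 < r) (y : Euc n) :
    phiT n s θ r y ≤ 1 := by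
  unfold phiT
  split_ifs with h1 h2
  · exact le_rfl
  · have h : r ≤ ‖y‖ := not_lt.1 h1
    exact Real.rpow_le_one (by positivity) ((div_le_one (hr.trans_le h)).2 h) hs
  · exact zero_le_one

theorem rpow_le_phiT {n : ℕ} {s θ r R : ℝ} (hs : 0 ≤ s) (hr : 0 < r) (hrR : r ≤ R)
    (hR : R ≤ r ^ θ) {y : Euc n} (hy : ‖y‖ ≤ R) : (r / R) ^ s ≤ phiT n s θ r y := by
  have hR0 : 0 < R := hr.trans_le hrR
  unfold phiT
  split_ifs with h1 h2
  · exact Real.rpow_le_one (by positivity) ((div_le_one hR0).2 hrR) hs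
  · have h : 0 < ‖y‖ := hr.trans_le (not_lt.1 h1)
    gcongr
  · exact absurd (hy.trans hR) h2

theorem ofReal_phiT_le {n : ℕ} {s θ r R τ : ℝ} (hs : 0 ≤ s) (hr : 0 < r) (hR : 0 < R)
    (hτ : 0 ≤ τ) {y : Euc n} (hy : ‖y‖ = R * τ) :
    ENNReal.ofReal (phiT n s θ r y) ≤
      ENNReal.ofReal ((r / R) ^ s) * ENNReal.ofReal τ ^ (-s) := by
  rcases hτ.eq_or_lt with rfl | hτ
  · rcases hs.eq_or_lt with rfl | hs
    · simpa using phiT_le_one le_rfl hr y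
    · have h0 : ENNReal.ofReal ((r / R) ^ s) ≠ 0 := by
        rw [Ne, ENNReal.ofReal_eq_zero, not_le]
        positivity
      rw [ENNReal.ofReal_zero, ENNReal.zero_rpow_of_neg (by linarith), ENNReal.mul_top h0]
      exact le_top
  · rw [ENNReal.ofReal_rpow_of_pos hτ, ← ENNReal.ofReal_mul (by positivity)]
    have h : (r / R) ^ s * τ ^ (-s) = (r / (R * τ)) ^ s := by
      rw [Real.rpow_neg hτ.le, ← div_eq_mul_inv, ← Real.div_rpow (by positivity) hτ.le, div_div]
    rw [h, ← hy]
    have hy0 : 0 < ‖y‖ := by rw [hy]; positivity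
    refine ENNReal.ofReal_le_ofReal ?_
    unfold phiT
    split_ifs with h1 h2
    · exact Real.one_le_rpow ((one_le_div hy0).2 h1.le) hs
    · exact le_rfl
    · positivity

theorem measurable_phiT_projMap {n : ℕ} (s θ r : ℝ) (x : Euc n) :
    Measurable fun P : Matrix (Fin n) (Fin n) ℝ => phiT n s θ r (projMap n P x) := by
  have h := measurable_norm_projMap_left x
  unfold phiT
  exact Measurable.ite (measurableSet_lt h measurable_const) measurable_const
    (Measurable.ite (measurableSet_le h measurable_const)
      ((h.const_div r).pow_const s) measurable_const)

theorem integrable_phiT_projMap {n : ℕ} {γ : Measure (Matrix (Fin n) (Fin n) ℝ)}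
    [IsFiniteMeasure γ] {s θ r : ℝ} (hs : 0 ≤ s) (hr : 0 < r) (x : Euc n) :
    Integrable (fun P => phiT n s θ r (projMap n P x)) γ :=
  Integrable.of_bound (measurable_phiT_projMap s θ r x).aestronglyMeasurable 1
    (Eventually.of_forall fun P => by
      rw [Real.norm_of_nonneg (phiT_nonneg hr _)]
      exact phiT_le_one hs hr _)

theorem integral_phiT_le_one {n : ℕ} {γ : Measure (Matrix (Fin n) (Fin n) ℝ)}
    [IsProbabilityMeasure γ] {s θ r : ℝ} (hs : 0 ≤ s) (hr : 0 < r) (x : Euc n) :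
    ∫ P, phiT n s θ r (projMap n P x) ∂γ ≤ 1 := by
  refine (integral_mono (integrable_phiT_projMap hs hr x) (integrable_const (1 : ℝ))
    fun P => phiT_le_one hs hr _).trans_eq ?_
  simp

theorem le_integral_phiT_of_norm_le {n m : ℕ} {γ : Measure (Matrix (Fin n) (Fin n) ℝ)}
    (hγ : IsGrassMeasure n m γ) {s θ r R : ℝ} (hs : 0 ≤ s) (hr : 0 < r) (hrR : r ≤ R)
    (hR : R ≤ r ^ θ) {x : Euc n} (hx : ‖x‖ ≤ R) :
    (r / R) ^ s ≤ ∫ P, phiT n s θ r (projMap n P x) ∂γ := by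
  have := hγ.1
  calc (r / R) ^ s = ∫ _, (r / R) ^ s ∂γ := by simp
    _ ≤ _ := by
      refine integral_mono_ae (integrable_const _) (integrable_phiT_projMap hs hr x)
        (hγ.ae_isProjMat.mono fun P hP => ?_)
      exact rpow_le_phiT hs hr hrR hR ((norm_projMap_le hP x).trans hx)

theorem norm_projMap_eq_norm_mul {n : ℕ} (P : Matrix (Fin n) (Fin n) ℝ) {x : Euc n}
    (hx : x ≠ 0) : ‖projMap n P x‖ = ‖x‖ * ‖projMap n P (‖x‖⁻¹ • x)‖ := by
  rw [projMap_smul, norm_smul, norm_inv, norm_norm, mul_inv_cancel_left₀ (norm_ne_zero_iff.2 hx)]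

theorem rpow_mul_measure_le_integral_phiT {n : ℕ} {γ : Measure (Matrix (Fin n) (Fin n) ℝ)}
    [IsFiniteMeasure γ] {s θ r : ℝ} (hs : 0 ≤ s) (hr : 0 < r) (hrθ : r ≤ r ^ θ) {x : Euc n}
    (hx : x ≠ 0) :
    (r / r ^ θ) ^ s * γ.real {P | ‖projMap n P (‖x‖⁻¹ • x)‖ ≤ r ^ θ / ‖x‖} ≤
      ∫ P, phiT n s θ r (projMap n P x) ∂γ := by
  have hx0 : 0 < ‖x‖ := norm_pos_iff.2 hx
  set E := {P : Matrix (Fin n) (Fin n) ℝ | ‖projMap n P (‖x‖⁻¹ • x)‖ ≤ r ^ θ / ‖x‖}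
  have hE : MeasurableSet E := measurableSet_le (measurable_norm_projMap_left _) measurable_const
  calc (r / r ^ θ) ^ s * γ.real E = ∫ P, E.indicator (fun _ => (r / r ^ θ) ^ s) P ∂γ := by
        rw [integral_indicator_const _ hE, smul_eq_mul, mul_comm]
    _ ≤ _ := by
      refine integral_mono ((integrable_const _).indicator hE)
        (integrable_phiT_projMap hs hr x) fun P => ?_
      by_cases hP : P ∈ E
      · rw [indicator_of_mem hP]
        refine rpow_le_phiT hs hr hrθ le_rfl ?_
        rw [norm_projMap_eq_norm_mul P hx]
        exact (le_div_iff₀' hx0).1 hP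
      · rw [indicator_of_notMem hP]
        exact phiT_nonneg hr _

/-- Passage from a bound on the truncated power of `‖π_V u‖`, `u = x / ‖x‖`, to a bound on the
average of `φ̃` at `x`. -/
theorem integral_phiT_le_of_truncPow {n m : ℕ} {γ : Measure (Matrix (Fin n) (Fin n) ℝ)}
    (hγ : IsGrassMeasure n m γ) {s θ r t B : ℝ} (hs : 0 ≤ s) (hr : 0 < r) (hrθ : r ≤ r ^ θ)
    {x : Euc n} (hx : x ≠ 0) (ht : t = 1 ∨ t = r ^ θ / ‖x‖) (hB : 0 ≤ B)
    (h : ∫⁻ P, truncPow s t ‖projMap n P (‖x‖⁻¹ • x)‖ ∂γ ≤ ENNReal.ofReal B) :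
    ∫ P, phiT n s θ r (projMap n P x) ∂γ ≤ (r / ‖x‖) ^ s * B := by
  have := hγ.1
  have hx0 : 0 < ‖x‖ := norm_pos_iff.2 hx
  have hu : ‖‖x‖⁻¹ • x‖ = 1 := by
    rw [norm_smul, norm_inv, norm_norm, inv_mul_cancel₀ hx0.ne']
  rw [← ENNReal.ofReal_le_ofReal_iff (by positivity),
    ofReal_integral_eq_lintegral_ofReal (integrable_phiT_projMap hs hr x)
      (Eventually.of_forall fun P => phiT_nonneg hr _), ENNReal.ofReal_mul (by positivity)]
  calc ∫⁻ P, ENNReal.ofReal (phiT n s θ r (projMap n P x)) ∂γ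
      ≤ ∫⁻ P, ENNReal.ofReal ((r / ‖x‖) ^ s) *
          truncPow s t ‖projMap n P (‖x‖⁻¹ • x)‖ ∂γ := by
        refine lintegral_mono_ae (hγ.ae_isProjMat.mono fun P hP => ?_)
        have hPx := norm_projMap_eq_norm_mul P hx
        by_cases hPt : ‖projMap n P (‖x‖⁻¹ • x)‖ ≤ t
        · rw [truncPow, if_pos hPt]
          exact ofReal_phiT_le hs hr hx0 (norm_nonneg _) hPx
        · rcases ht with rfl | rfl
          · exact absurd ((norm_projMap_le hP _).trans hu.le) hPt
          · have h1 : r ^ θ < ‖projMap n P x‖ := by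
              rw [hPx]
              exact (div_lt_iff₀' hx0).1 (not_le.1 hPt)
            rw [phiT, if_neg (not_lt.2 (hrθ.trans h1.le)), if_neg (not_le.2 h1)]
            simp
    _ = ENNReal.ofReal ((r / ‖x‖) ^ s) *
          ∫⁻ P, truncPow s t ‖projMap n P (‖x‖⁻¹ • x)‖ ∂γ :=
        lintegral_const_mul _ ((measurable_truncPow s t).comp (measurable_norm_projMap_left _))
    _ ≤ _ := by gcongr

theorem rpow_div_rpow_eq {m s θ r R : ℝ} (hr : 0 < r) (hR : 0 < R) :
    r ^ (θ * (m - s) + s) / R ^ m = (r / R) ^ s * (r ^ θ / R) ^ (m - s) := by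
  have hρ : 0 < r ^ θ := Real.rpow_pos_of_pos hr θ
  rw [Real.rpow_add hr, Real.rpow_mul hr.le, Real.div_rpow hr.le hR.le,
    Real.div_rpow hρ.le hR.le, div_mul_div_comm, ← Real.rpow_add hR, add_sub_cancel, mul_comm]

theorem rpow_div_rpow_eq' {m s θ r R : ℝ} (hr : 0 < r) (hR : 0 < R) :
    r ^ (θ * (m - s) + s) / R ^ m = (r / r ^ θ) ^ s * (r ^ θ / R) ^ m := by
  have hρ : 0 < r ^ θ := Real.rpow_pos_of_pos hr θ
  rw [Real.rpow_add hr, Real.rpow_mul hr.le, Real.rpow_sub hρ, Real.div_rpow hr.le hρ.le,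
    Real.div_rpow hρ.le hR.le]
  field_simp

theorem phiK_nonneg {n : ℕ} {m s θ r : ℝ} (hr : 0 < r) (x : Euc n) : 0 ≤ phiK n m s θ r x := by
  unfold phiK
  split_ifs <;> positivity

/-- Two-sided comparison of the kernel `φ_{r,θ}^{s,m}(x)` with
`∫ φ̃_{r,θ}^s(π_V x) dγ_{n,m}(V)`, with constants depending only on `n`, `m` and `s`. -/
theorem statement15 (n m : ℕ) (hm1 : 1 ≤ m) (hmn : m ≤ n - 1) (s : ℝ) (hs0 : 0 ≤ s)
    (hsm : s < m) (γ : Measure (Matrix (Fin n) (Fin n) ℝ)) (hγ : IsGrassMeasure n m γ) :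
    ∃ a : ℝ, 0 < a ∧ ∃ b : ℝ, 0 < b ∧
      ∀ x : Euc n, ∀ θ : ℝ, θ ∈ Ioc (0:ℝ) 1 → ∀ r : ℝ, 0 < r → r < 1/2 →
        a * (∫ P, phiT n s θ r (projMap n P x) ∂γ) ≤ phiK n m s θ r x ∧
        phiK n m s θ r x ≤ b * (∫ P, phiT n s θ r (projMap n P x) ∂γ) := by
  have := hγ.1
  obtain ⟨C, hC, hupper⟩ := hγ.exists_lintegral_truncPow_le hm1 hs0 hsm
  obtain ⟨c, hc, hlower⟩ := hγ.exists_le_measure_norm_projMap_le hm1 (by omega)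
  refine ⟨(1 + C)⁻¹, by positivity, 1 + c⁻¹, by positivity, fun x θ hθ r hr hr2 => ?_⟩
  have hrθ : r ≤ r ^ θ := Real.self_le_rpow_of_le_one hr.le (by linarith) hθ.2
  have hρ : 0 < r ^ θ := Real.rpow_pos_of_pos hr θ
  set I := ∫ P, phiT n s θ r (projMap n P x) ∂γ
  have hI0 : 0 ≤ I := integral_nonneg_of_ae <| Eventually.of_forall fun P =>
    phiT_nonneg hr (projMap n P x)
  have hφ0 : 0 ≤ phiK n m s θ r x := phiK_nonneg hr x
  suffices h : I ≤ (1 + C) * phiK n m s θ r x ∧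
      (phiK n m s θ r x ≤ I ∨ phiK n m s θ r x ≤ c⁻¹ * I) by
    refine ⟨(inv_mul_le_iff₀ (by positivity)).2 h.1, ?_⟩
    have hcI : 0 ≤ c⁻¹ * I := mul_nonneg (inv_nonneg.2 hc.le) hI0
    rcases h.2 with h | h <;> linarith
  unfold phiK at hφ0 ⊢
  by_cases h1 : ‖x‖ < r
  · simp only [if_pos h1]
    constructor
    · have hI1 : I ≤ 1 := integral_phiT_le_one hs0 hr x
      linarith
    · left
      simpa [hr.ne'] using le_integral_phiT_of_norm_le hγ hs0 hr le_rfl hrθ h1.le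
  have hrx : r ≤ ‖x‖ := not_lt.1 h1
  have hx0 : 0 < ‖x‖ := hr.trans_le hrx
  have hx : x ≠ 0 := norm_pos_iff.1 hx0
  have hu : ‖‖x‖⁻¹ • x‖ = 1 := by
    rw [norm_smul, norm_inv, norm_norm, inv_mul_cancel₀ hx0.ne']
  simp only [if_neg h1] at hφ0 ⊢
  by_cases h2 : ‖x‖ < r ^ θ
  · simp only [if_pos h2] at hφ0 ⊢
    constructor
    · have h := integral_phiT_le_of_truncPow hγ hs0 hr hrθ hx (Or.inl rfl)
        (by positivity) (hupper _ hu 1 one_pos)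
      rw [Real.one_rpow, mul_one] at h
      linarith
    · left
      exact le_integral_phiT_of_norm_le hγ hs0 hr hrx h2.le le_rfl
  · simp only [if_neg h2] at hφ0 ⊢
    constructor
    · have h := integral_phiT_le_of_truncPow hγ hs0 hr hrθ hx (Or.inr rfl)
        (by positivity) (hupper _ hu (r ^ θ / ‖x‖) (by positivity))
      rw [mul_left_comm, ← rpow_div_rpow_eq hr hx0] at h
      linarith
    · right
      have h := hlower _ hu (r ^ θ / ‖x‖) (by positivity) ((div_le_one hx0).2 (not_lt.1 h2))
      rw [ENNReal.ofReal_le_iff_le_toReal (measure_ne_top _ _)] at h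
      rw [rpow_div_rpow_eq' hr hx0, Real.rpow_natCast, le_inv_mul_iff₀ hc, mul_left_comm]
      refine le_trans ?_ (rpow_mul_measure_le_integral_phiT hs0 hr hrθ hx)
      exact mul_le_mul_of_nonneg_left h (by positivity)
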